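/- Every graph G with maximum average degree at most 28/9 is (1,3)-colorable, where the maximum average degree of G is the maximum over all nonempty subgraphs H of G of 2|E(H)|/|V(H)|. -/

import Mathlib

/-- G is (1,3)-colorable. -/
def Colorable13 {V : Type*} (G : SimpleGraph V) : Prop :=
  ∃ f : V → Bool,
    (∀ v, f v = true → (G.neighborSet v ∩ {u | f u = true}).ncard ≤ 1) ∧
    (∀ v, f v = false → (G.neighborSet v ∩ {u | f u = false}).ncard ≤ 3)

namespace DefectiveColoring

open Finset

set_option linter.unusedSectionVars false

variable {V : Type*} [DecidableEq V] (G : SimpleGraph V) [DecidableRel G.Adj]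

/-- The neighbours of `v` inside `U`. -/
def nb (U : Finset V) (v : V) : Finset V := U.filter (G.Adj v)

/-- `f` colors `U` so that `v` has at most `c (f v) v` neighbours of its own color. -/
def Valid (c : Bool → V → ℤ) (U : Finset V) (f : V → Bool) : Prop :=
  ∀ v ∈ U, (#((nb G U v).filter (fun u => f u = f v)) : ℤ) ≤ c (f v) v

/-- Capacities lie in `{-1, 0, 1}` for `true` and in `{-1, 0, 1, 2, 3}` for `false`. -/
def Bounded (c : Bool → V → ℤ) : Prop :=
  ∀ v, (-1 ≤ c true v ∧ c true v ≤ 1) ∧ (-1 ≤ c false v ∧ c false v ≤ 3)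

/-- The weight of a vertex, determined by its capacities. -/
def wt (c : Bool → V → ℤ) (v : V) : ℤ := 4 * c true v + 3 * max (c false v) 0 + 1

/-- The number of edges inside `U`. -/
def numEdges (U : Finset V) : ℤ := (∑ v ∈ U, (#(nb G U v) : ℤ)) / 2

/-- The potential of a vertex set. -/
def pot (c : Bool → V → ℤ) (U : Finset V) : ℤ := ∑ v ∈ U, wt c v - 9 * numEdges G U

/-- Every nonempty subset of `U` has large potential. -/
def Sparse (c : Bool → V → ℤ) (U : Finset V) : Prop :=
  ∀ A ⊆ U, A.Nonempty →
    -5 ≤ pot G c A ∧ ((∀ v ∈ A, c false v = -1) → -2 ≤ pot G c A)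

variable {G}

lemma mem_nb {U : Finset V} {u v : V} : u ∈ nb G U v ↔ u ∈ U ∧ G.Adj v u := by
  simp [nb]

lemma nb_union (A B : Finset V) (v : V) : nb G (A ∪ B) v = nb G A v ∪ nb G B v := by
  simp [nb, filter_union]

lemma card_nb_union {A B : Finset V} (h : Disjoint A B) (v : V) :
    #(nb G (A ∪ B) v) = #(nb G A v) + #(nb G B v) := by
  rw [nb_union, card_union_of_disjoint]
  exact disjoint_filter_filter h

lemma sum_nb_comm (A B : Finset V) :
    ∑ b ∈ B, (#(nb G A b) : ℤ) = ∑ a ∈ A, (#(nb G B a) : ℤ) := by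
  have := Finset.sum_card_bipartiteAbove_eq_sum_card_bipartiteBelow (s := A) (t := B) G.Adj
  unfold bipartiteAbove bipartiteBelow at this
  simp only [nb]
  have h2 : ∀ b, A.filter (G.Adj b) = A.filter (fun a => G.Adj a b) := by
    intro b; ext a; simp [G.adj_comm]
  simp only [h2]
  exact_mod_cast this.symm

lemma sum_nb_union {A B : Finset V} (h : Disjoint A B) :
    ∑ v ∈ A ∪ B, (#(nb G (A ∪ B) v) : ℤ) =
      ∑ v ∈ A, (#(nb G A v) : ℤ) + ∑ v ∈ B, (#(nb G B v) : ℤ) +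
        2 * ∑ b ∈ B, (#(nb G A b) : ℤ) := by
  rw [sum_union h]
  simp only [card_nb_union h, Nat.cast_add, sum_add_distrib]
  rw [sum_nb_comm A B]
  ring

lemma two_dvd_sum_nb (U : Finset V) : (2 : ℤ) ∣ ∑ v ∈ U, (#(nb G U v) : ℤ) := by
  induction U using Finset.induction_on with
  | empty => simp
  | insert a s ha ih =>
    have hd : Disjoint {a} s := by simpa using ha
    rw [insert_eq, sum_nb_union hd]
    have h0 : nb G {a} a = ∅ := by ext; simp [mem_nb]; rintro rfl; simp
    rw [sum_singleton, h0]
    simp only [card_empty, Nat.cast_zero, zero_add]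
    exact dvd_add ih (dvd_mul_right _ _)

lemma two_mul_numEdges (U : Finset V) :
    2 * numEdges G U = ∑ v ∈ U, (#(nb G U v) : ℤ) :=
  Int.mul_ediv_cancel' (two_dvd_sum_nb U)

lemma pot_union (c : Bool → V → ℤ) {A B : Finset V} (h : Disjoint A B) :
    pot G c (A ∪ B) = pot G c A + pot G c B - 9 * ∑ b ∈ B, (#(nb G A b) : ℤ) := by
  have h1 := sum_nb_union (G := G) h
  simp only [← two_mul_numEdges] at h1
  simp only [pot, sum_union h]
  linarith

lemma pot_singleton (c : Bool → V → ℤ) (v : V) : pot G c {v} = wt c v := by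
  have h0 : nb G {v} v = ∅ := by ext; simp [mem_nb]; rintro rfl; simp
  simp [pot, numEdges, h0]

lemma pot_insert (c : Bool → V → ℤ) {A : Finset V} {v : V} (h : v ∉ A) :
    pot G c (insert v A) = pot G c A + wt c v - 9 * #(nb G A v) := by
  have hd : Disjoint A {v} := by simpa using h
  rw [insert_eq, union_comm, pot_union c hd, pot_singleton]
  simp

lemma two_mul_pot (c : Bool → V → ℤ) (U : Finset V) :
    2 * pot G c U = ∑ v ∈ U, (2 * wt c v - 9 * (#(nb G U v) : ℤ)) := by
  rw [sum_sub_distrib, ← mul_sum, ← mul_sum, ← two_mul_numEdges, pot]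
  ring

lemma Sparse.mono {c : Bool → V → ℤ} {A U : Finset V} (h : Sparse G c U) (hA : A ⊆ U) :
    Sparse G c A := fun B hB => h B (hB.trans hA)

/-- Two colorings of disjoint sets can be glued if at most one pair across gets the same color
and there is room for that pair. -/
lemma Valid.glue {c c' : Bool → V → ℤ} {A B : Finset V} {f g : V → Bool} {a₀ b₀ : V}
    (hd : Disjoint A B) (hf : Valid G c A f) (hg : Valid G c' B g)
    (hc : ∀ i, ∀ b ∈ B, c' i b ≤ c i b)
    (hab : ∀ a ∈ A, ∀ b ∈ B, G.Adj a b → f a = g b → a = a₀ ∧ b = b₀ ∧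
      (#((nb G A a₀).filter (fun u => f u = f a₀)) : ℤ) + 1 ≤ c (f a₀) a₀ ∧
      c' (f a₀) b₀ + 1 ≤ c (f a₀) b₀) :
    ∃ k, Valid G c (A ∪ B) k := by
  refine ⟨fun v => if v ∈ A then f v else g v, ?_⟩
  have hB : ∀ b ∈ B, b ∉ A := fun b hb ha => (disjoint_left.1 hd ha hb)
  intro v hv
  rcases mem_union.1 hv with hv | hv
  · have h1 := hf v hv
    simp only [if_pos hv]
    by_cases h : ∃ b ∈ B, G.Adj v b ∧ f v = g b
    · obtain ⟨b, hb, hvb, he⟩ := h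
      obtain ⟨rfl, rfl, h2, h3⟩ := hab v hv b hb hvb he
      have hs : (nb G (A ∪ B) v).filter (fun u => (if u ∈ A then f u else g u) = f v) ⊆
          insert b ((nb G A v).filter (fun u => f u = f v)) := by
        intro u hu
        simp only [mem_filter, mem_nb, mem_union, mem_insert] at hu ⊢
        obtain ⟨⟨hu1, hu2⟩, hu3⟩ := hu
        by_cases huA : u ∈ A
        · simp_all
        · have huB : u ∈ B := by tauto
          rw [if_neg huA] at hu3
          exact Or.inl (hab v hv u huB hu2 hu3.symm).2.1
      have := (card_le_card hs).trans (card_insert_le _ _)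
      omega
    · push Not at h
      refine le_trans ?_ h1
      norm_cast
      apply card_le_card
      intro u hu
      simp only [mem_filter, mem_nb, mem_union] at hu ⊢
      obtain ⟨⟨hu1, hu2⟩, hu3⟩ := hu
      by_cases huA : u ∈ A
      · simp_all
      · have huB : u ∈ B := by tauto
        rw [if_neg huA] at hu3
        exact absurd hu3.symm (h u huB hu2)
  · have h1 := hg v hv
    have h1' := hc (g v) v hv
    simp only [if_neg (hB v hv)]
    by_cases h : ∃ a ∈ A, G.Adj v a ∧ f a = g v
    · obtain ⟨a, ha, hva, he⟩ := h
      obtain ⟨rfl, rfl, h2, h3⟩ := hab a ha v hv hva.symm he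
      rw [he] at h3
      have hs : (nb G (A ∪ B) v).filter (fun u => (if u ∈ A then f u else g u) = g v) ⊆
          insert a ((nb G B v).filter (fun u => g u = g v)) := by
        intro u hu
        simp only [mem_filter, mem_nb, mem_union, mem_insert] at hu ⊢
        obtain ⟨⟨hu1, hu2⟩, hu3⟩ := hu
        by_cases huA : u ∈ A
        · rw [if_pos huA] at hu3
          exact Or.inl (hab u huA v hv hu2.symm hu3).1
        · simp_all
      have := (card_le_card hs).trans (card_insert_le _ _)
      omega
    · push Not at h
      refine le_trans ?_ (h1.trans h1')
      norm_cast
      apply card_le_card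
      intro u hu
      simp only [mem_filter, mem_nb, mem_union] at hu ⊢
      obtain ⟨⟨hu1, hu2⟩, hu3⟩ := hu
      by_cases huA : u ∈ A
      · rw [if_pos huA] at hu3
        exact absurd hu3 (h u huA hu2)
      · simp_all

/-- Extending a coloring by one vertex. -/
lemma Valid.insert {c : Bool → V → ℤ} {A : Finset V} {f : V → Bool} {x : V} (hx : x ∉ A)
    (hf : Valid G c A f) (i : Bool) (hi : (#((nb G A x).filter (fun u => f u = i)) : ℤ) ≤ c i x)
    (hs : ∀ a ∈ nb G A x, f a = i →
      (#((nb G A a).filter (fun u => f u = f a)) : ℤ) + 1 ≤ c (f a) a) :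
    ∃ k, Valid G c (insert x A) k := by
  refine ⟨Function.update f x i, ?_⟩
  have hne : ∀ a ∈ A, a ≠ x := fun a ha h => hx (h ▸ ha)
  intro v hv
  rcases mem_insert.1 hv with rfl | hv
  · simp only [Function.update_self]
    refine le_trans ?_ hi
    norm_cast
    apply card_le_card
    intro u hu
    simp only [mem_filter, mem_nb, mem_insert] at hu ⊢
    obtain ⟨⟨rfl | hu1, hu2⟩, hu3⟩ := hu
    · simp at hu2
    · rw [Function.update_of_ne (hne u hu1)] at hu3
      exact ⟨⟨hu1, hu2⟩, hu3⟩
  · rw [Function.update_of_ne (hne v hv)]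
    have hsub : (nb G (Insert.insert x A) v).filter (fun u => Function.update f x i u = f v) ⊆
        Insert.insert x ((nb G A v).filter (fun u => f u = f v)) := by
      intro u hu
      simp only [mem_filter, mem_nb, mem_insert] at hu ⊢
      obtain ⟨⟨rfl | hu1, hu2⟩, hu3⟩ := hu
      · exact Or.inl rfl
      · rw [Function.update_of_ne (hne u hu1)] at hu3
        exact Or.inr ⟨⟨hu1, hu2⟩, hu3⟩
    have h1 := hf v hv
    by_cases h : G.Adj x v ∧ f v = i
    · have h2 := hs v (mem_nb.2 ⟨hv, h.1⟩) h.2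
      have := (card_le_card hsub).trans (card_insert_le _ _)
      omega
    · refine le_trans ?_ h1
      norm_cast
      apply card_le_card
      intro u hu
      have hu' := hu
      rcases mem_insert.1 (hsub hu) with rfl | hu''
      · simp only [mem_filter, mem_nb, Function.update_self] at hu
        exact absurd ⟨hu.1.2.symm, hu.2.symm⟩ h
      · exact hu''

variable (G) in
/-- A minimal counterexample. -/
structure Critical (c : Bool → V → ℤ) (U : Finset V) : Prop where
  bounded : Bounded c
  sparse : Sparse G c U
  not_valid : ∀ f, ¬ Valid G c U f
  exists_valid : ∀ A ⊂ U, ∀ c', Bounded c' → Sparse G c' A → ∃ f, Valid G c' A f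

/-- Lowering by one the capacities for color `i` at the vertices of `S i`. -/
def lower (c : Bool → V → ℤ) (S : Bool → Finset V) (i : Bool) (v : V) : ℤ :=
  if v ∈ S i then max (-1) (c i v - 1) else c i v

lemma Bounded.lower {c : Bool → V → ℤ} (h : Bounded c) (S : Bool → Finset V) :
    Bounded (lower c S) := by
  intro v
  have := h v
  simp only [DefectiveColoring.lower]
  refine ⟨?_, ?_⟩ <;> split_ifs <;> refine ⟨?_, ?_⟩ <;> omega

lemma lower_le {c : Bool → V → ℤ} (h : Bounded c) (S : Bool → Finset V) (i : Bool) (v : V) :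
    lower c S i v ≤ c i v := by
  have := h v
  simp only [lower]
  cases i <;> split_ifs <;> omega

lemma Valid.of_le {c c' : Bool → V → ℤ} {A : Finset V} {f : V → Bool} (hf : Valid G c' A f)
    (h : ∀ i, ∀ v ∈ A, c' i v ≤ c i v) : Valid G c A f :=
  fun v hv => (hf v hv).trans (h _ v hv)

lemma Valid.strict {c : Bool → V → ℤ} {S : Bool → Finset V} {A : Finset V} {f : V → Bool}
    (hf : Valid G (lower c S) A f) {v : V} (hv : v ∈ A) (hS : v ∈ S (f v)) :
    (#((nb G A v).filter (fun u => f u = f v)) : ℤ) + 1 ≤ c (f v) v := by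
  have := hf v hv
  simp only [lower, if_pos hS] at this
  omega

lemma le_pot_lower {c : Bool → V → ℤ} (hc : Bounded c) (S : Bool → Finset V) (A : Finset V) :
    pot G c A - 4 * #(A.filter (· ∈ S true)) -
      3 * #(A.filter (fun v => v ∈ S false ∧ 1 ≤ c false v)) ≤ pot G (lower c S) A := by
  have h : ∑ v ∈ A, (wt c v - 4 * (if v ∈ S true then 1 else 0) -
      3 * (if v ∈ S false ∧ 1 ≤ c false v then 1 else 0)) ≤ ∑ v ∈ A, wt (lower c S) v := by
    apply sum_le_sum
    intro v _
    have := hc v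
    by_cases h1 : v ∈ S true <;> by_cases h2 : v ∈ S false <;>
      simp only [wt, lower, h1, h2, true_and, false_and, if_true, if_false] <;>
      (try split_ifs) <;> omega
  simp only [sum_sub_distrib, ← mul_sum, sum_boole] at h
  simp only [pot]
  linarith

lemma Critical.exists_lower {c : Bool → V → ℤ} {U A : Finset V} (h : Critical G c U)
    (hA : A ⊂ U) (S : Bool → Finset V)
    (h1 : ∀ B ⊆ A, B.Nonempty → -5 ≤ pot G c B - 4 * #(B.filter (· ∈ S true)) -
      3 * #(B.filter (fun v => v ∈ S false ∧ 1 ≤ c false v)))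
    (h2 : ∀ B ⊆ A, B.Nonempty → (∀ v ∈ B, lower c S false v = -1) →
      -2 ≤ pot G c B - 4 * #(B.filter (· ∈ S true))) :
    ∃ f, Valid G (lower c S) A f := by
  refine h.exists_valid A hA _ (h.bounded.lower S) fun B hB hn => ⟨?_, fun hf => ?_⟩
  · exact (h1 B hB hn).trans (le_pot_lower h.bounded S B)
  · have h3 := le_pot_lower (G := G) h.bounded S B
    have h4 := h2 B hB hn hf
    have h5 : B.filter (fun v => v ∈ S false ∧ 1 ≤ c false v) = ∅ := by
      rw [filter_eq_empty_iff]
      rintro v hv ⟨-, hv1⟩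
      have := hf v hv
      simp only [lower] at this
      split_ifs at this <;> omega
    rw [h5] at h3
    simp only [card_empty] at h3
    push_cast at h3
    omega

variable (G) in
/-- The vertices of full capacity having exactly two neighbours. -/
def twos (c : Bool → V → ℤ) (U : Finset V) : Finset V :=
  U.filter (fun v => c true v = 1 ∧ c false v = 3 ∧ #(nb G U v) = 2)

variable (G) in
/-- Nonempty proper subsets not obtained by deleting one vertex of `twos`. -/
def Regular (c : Bool → V → ℤ) (U A : Finset V) : Prop :=
  A ⊆ U ∧ A.Nonempty ∧ A ≠ U ∧ ∀ v ∈ twos G c U, A ≠ U.erase v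

lemma Regular.mono {c : Bool → V → ℤ} {U A B : Finset V} (h : Regular G c U A) (hB : B ⊆ A)
    (hn : B.Nonempty) : Regular G c U B := by
  refine ⟨hB.trans h.1, hn, ?_, ?_⟩
  · rintro rfl
    exact h.2.2.1 (subset_antisymm h.1 hB)
  · rintro v hv rfl
    by_cases hvA : v ∈ A
    · apply h.2.2.1
      refine subset_antisymm h.1 fun u hu => ?_
      by_cases huv : u = v
      · exact huv ▸ hvA
      · exact hB (mem_erase.2 ⟨huv, hu⟩)
    · refine h.2.2.2 v hv (subset_antisymm (fun u hu => mem_erase.2 ⟨?_, h.1 hu⟩) hB)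
      rintro rfl
      exact hvA hu

lemma Regular.ssubset {c : Bool → V → ℤ} {U A : Finset V} (h : Regular G c U A) : A ⊂ U :=
  h.1.ssubset_of_ne h.2.2.1

lemma regular_of_notMem {c : Bool → V → ℤ} {U A : Finset V} {x : V} (hA : A ⊆ U)
    (hn : A.Nonempty) (hx : x ∈ U) (hxA : x ∉ A) (hxt : x ∉ twos G c U) : Regular G c U A := by
  refine ⟨hA, hn, ?_, ?_⟩
  · rintro rfl; exact hxA hx
  · rintro v hv rfl
    apply hxA
    refine mem_erase.2 ⟨?_, hx⟩
    rintro rfl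
    exact hxt hv

lemma pot_erase {c : Bool → V → ℤ} {U : Finset V} {v : V} (hv : v ∈ U) :
    pot G c U = pot G c (U.erase v) + wt c v - 9 * #(nb G U v) := by
  have h := pot_insert (G := G) c (notMem_erase v U)
  rw [insert_erase hv] at h
  rw [h]
  congr 4
  ext u
  simp only [mem_nb, mem_erase]
  constructor
  · tauto
  · rintro ⟨h1, h2⟩
    exact ⟨⟨h2.ne', h1⟩, h2⟩

lemma pot_erase_twos {c : Bool → V → ℤ} {U : Finset V} {v : V} (hv : v ∈ twos G c U) :
    pot G c U = pot G c (U.erase v) - 4 := by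
  simp only [twos, mem_filter] at hv
  rw [pot_erase hv.1, hv.2.2.2, wt, hv.2.1, hv.2.2.1]
  norm_num
  ring

/-- How much is lost when passing to reduced capacities on the complement of a set of minimal
potential. -/
lemma Critical.defect {c c' : Bool → V → ℤ} {U A : Finset V} (h : Critical G c U)
    (hA : Regular G c U A) (hmin : ∀ B, Regular G c U B → pot G c A ≤ pot G c B)
    (hle : pot G c A ≤ 1) (hc' : Bounded c')
    (hw : ∀ b ∈ U \ A, wt c b ≤ wt c' b + 9 * #(nb G A b))
    (hnv : ∀ g, ¬ Valid G c' (U \ A) g) :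
    (pot G c A = 1 ∧ ∀ b ∈ U \ A, wt c' b + 9 * #(nb G A b) = wt c b) ∨
    (-2 ≤ pot G c A ∧ ∀ b ∈ U \ A, c' false b = -1 ∧
      wt c' b + 9 * #(nb G A b) ≤ wt c b + pot G c A + 2) := by
  have hU := h.sparse U subset_rfl (hA.2.1.mono hA.1)
  have hns : ¬ Sparse G c' (U \ A) := by
    intro hs
    have hss : U \ A ⊂ U := sdiff_ssubset hA.1 hA.2.1
    obtain ⟨g, hg⟩ := h.exists_valid _ hss c' hc' hs
    exact hnv g hg
  simp only [Sparse, not_forall] at hns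
  obtain ⟨B, hB, hn, hbad⟩ := hns
  have hd : Disjoint A B := disjoint_of_subset_right hB disjoint_sdiff
  have hpu := pot_union (G := G) c hd
  have hsum : pot G c' B - pot G c B + 9 * ∑ b ∈ B, (#(nb G A b) : ℤ) =
      ∑ b ∈ B, (wt c' b + 9 * #(nb G A b) - wt c b) := by
    rw [sum_sub_distrib, sum_add_distrib, ← mul_sum]
    simp only [pot]
    ring
  have hnn : ∀ b ∈ B, 0 ≤ wt c' b + 9 * (#(nb G A b) : ℤ) - wt c b := by
    intro b hb
    have := hw b (hB hb)
    linarith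
  have hs0 := sum_nonneg hnn
  have hneg : pot G c' B < -2 := by
    by_contra hcon
    apply hbad
    constructor
    · omega
    · intro; omega
  have hnr : ¬ Regular G c U (A ∪ B) := fun hr => by
    have := hmin _ hr
    omega
  have hBeq : A ∪ B = U := by
    by_contra hne
    apply hnr
    refine ⟨union_subset hA.1 (hB.trans sdiff_subset), hA.2.1.mono subset_union_left, hne, ?_⟩
    rintro v hv he
    have := pot_erase_twos hv
    rw [← he] at this
    omega
  have hB' : B = U \ A := by
    rw [← hBeq, union_sdiff_left, sdiff_eq_self_of_disjoint hd.symm]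
  rw [hBeq] at hpu
  have hone : ∀ b ∈ B, wt c' b + 9 * (#(nb G A b) : ℤ) - wt c b ≤
      ∑ b ∈ B, (wt c' b + 9 * #(nb G A b) - wt c b) := fun b hb =>
    single_le_sum hnn hb
  by_cases h5 : -5 ≤ pot G c' B
  · right
    have hforced : ∀ b ∈ B, c' false b = -1 := by
      by_contra hcon
      exact hbad ⟨h5, fun hf => absurd hf hcon⟩
    refine ⟨by omega, ?_⟩
    rw [← hB']
    intro b hb
    refine ⟨hforced b hb, ?_⟩
    have := hone b hb
    omega
  · left
    refine ⟨by omega, ?_⟩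
    rw [← hB']
    intro b hb
    have := hone b hb
    have := hnn b hb
    omega

variable (G) in
/-- The capacities left after coloring `A`, when no edge leaving `A` may be monochromatic. -/
def blocked (c : Bool → V → ℤ) (A : Finset V) (f : V → Bool) (i : Bool) (b : V) : ℤ :=
  if ∃ a ∈ nb G A b, f a = i then -1 else c i b

variable (G) in
/-- The capacities left after coloring `A`, when no edge leaving `A` may be monochromatic, except
for the edges at `b₀`. -/
def relaxed (c : Bool → V → ℤ) (A : Finset V) (f : V → Bool) (b₀ : V) (i : Bool) (b : V) : ℤ :=
  if b = b₀ then (if ∃ a ∈ nb G A b, f a = i then c i b - 1 else c i b) else blocked G c A f i b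

lemma two_le_card_nb {A : Finset V} {f : V → Bool} {b : V} (h1 : ∃ a ∈ nb G A b, f a = true)
    (h2 : ∃ a ∈ nb G A b, f a = false) : 2 ≤ #(nb G A b) := by
  obtain ⟨a, ha, ha'⟩ := h1
  obtain ⟨a', hb, hb'⟩ := h2
  refine Nat.succ_le_of_lt (one_lt_card.2 ⟨a, ha, a', hb, ?_⟩)
  rintro rfl
  simp_all

lemma one_le_card_nb {A : Finset V} {f : V → Bool} {b : V} {i : Bool}
    (h1 : ∃ a ∈ nb G A b, f a = i) : 1 ≤ #(nb G A b) := by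
  obtain ⟨a, ha, -⟩ := h1
  exact card_pos.2 ⟨a, ha⟩

lemma Bounded.blocked {c : Bool → V → ℤ} (hc : Bounded c) (A : Finset V) (f : V → Bool) :
    Bounded (blocked G c A f) := by
  intro v
  have := hc v
  simp only [DefectiveColoring.blocked]
  refine ⟨?_, ?_⟩ <;> split_ifs <;> refine ⟨?_, ?_⟩ <;> omega

lemma wt_le_wt_blocked {c : Bool → V → ℤ} (hc : Bounded c) (A : Finset V) (f : V → Bool) (b : V) :
    wt c b ≤ wt (blocked G c A f) b + 9 * #(nb G A b) := by
  have := hc b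
  have h1 := two_le_card_nb (G := G) (A := A) (f := f) (b := b)
  have h2 := one_le_card_nb (G := G) (A := A) (f := f) (b := b) (i := true)
  have h3 := one_le_card_nb (G := G) (A := A) (f := f) (b := b) (i := false)
  by_cases p : ∃ a ∈ nb G A b, f a = true <;> by_cases q : ∃ a ∈ nb G A b, f a = false <;>
    simp only [p, q, wt, blocked, if_true, if_false, forall_true_left] at h1 h2 h3 ⊢ <;> omega

lemma Critical.not_valid_blocked {c : Bool → V → ℤ} {U A : Finset V} (h : Critical G c U)
    (hA : A ⊆ U) {f : V → Bool} (hf : Valid G c A f) (g : V → Bool) :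
    ¬ Valid G (blocked G c A f) (U \ A) g := by
  intro hg
  have key : ∀ a ∈ A, ∀ b ∈ U \ A, G.Adj a b → f a ≠ g b := by
    intro a ha b hb hab he
    have h1 := hg b hb
    rw [blocked, if_pos ⟨a, mem_nb.2 ⟨ha, hab.symm⟩, he⟩] at h1
    omega
  by_cases hn : A.Nonempty
  · obtain ⟨a, -⟩ := hn
    obtain ⟨k, hk⟩ := hf.glue (a₀ := a) (b₀ := a) disjoint_sdiff hg
      (fun i b _ => by
        have := h.bounded b
        simp only [blocked]
        cases i <;> split_ifs <;> omega)
      (fun a ha b hb hab he => absurd he (key a ha b hb hab))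
    rw [union_sdiff_of_subset hA] at hk
    exact h.not_valid k hk
  · rw [not_nonempty_iff_eq_empty] at hn
    subst hn
    rw [sdiff_empty] at hg
    refine h.not_valid g fun v hv => ?_
    have := hg v hv
    simpa [blocked, nb] using this

lemma Critical.not_valid_relaxed {c : Bool → V → ℤ} {U A : Finset V} (h : Critical G c U)
    (hA : A ⊆ U) {f : V → Bool} (hf : Valid G c A f) {a₀ b₀ : V} (hab : nb G A b₀ = {a₀})
    (hs : (#((nb G A a₀).filter (fun u => f u = f a₀)) : ℤ) + 1 ≤ c (f a₀) a₀) (g : V → Bool) :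
    ¬ Valid G (relaxed G c A f b₀) (U \ A) g := by
  intro hg
  obtain ⟨k, hk⟩ := hf.glue (a₀ := a₀) (b₀ := b₀) disjoint_sdiff hg
    (fun i b _ => by
      have := h.bounded b
      simp only [relaxed, blocked]
      cases i <;> split_ifs <;> omega)
    (fun a ha b hb hadj he => by
      have hex : ∃ a ∈ nb G A b, f a = g b := ⟨a, mem_nb.2 ⟨ha, hadj.symm⟩, he⟩
      have h1 := hg b hb
      rw [relaxed, blocked, if_pos hex, if_pos hex] at h1
      by_cases hb0 : b = b₀
      · subst hb0
        have ha0 : a ∈ nb G A b := mem_nb.2 ⟨ha, hadj.symm⟩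
        rw [hab, mem_singleton] at ha0
        subst ha0
        refine ⟨rfl, rfl, hs, ?_⟩
        rw [relaxed, if_pos rfl, if_pos (he ▸ hex)]
        omega
      · rw [if_neg hb0] at h1
        omega)
  rw [union_sdiff_of_subset hA] at hk
  exact h.not_valid k hk

/-- The defect of `Critical.defect`, for the relaxed capacities. -/
lemma Critical.defect_relaxed {c : Bool → V → ℤ} {U A : Finset V} (h : Critical G c U)
    (hA : Regular G c U A) (hmin : ∀ B, Regular G c U B → pot G c A ≤ pot G c B)
    (hle : pot G c A ≤ 1) {f : V → Bool} (hf : Valid G c A f) {a₀ b₀ : V}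
    (hb₀ : b₀ ∈ U \ A) (hab : nb G A b₀ = {a₀}) (hc : 1 ≤ c (f a₀) b₀)
    (hs : (#((nb G A a₀).filter (fun u => f u = f a₀)) : ℤ) + 1 ≤ c (f a₀) a₀) : False := by
  have hbd := h.bounded
  have hrel : ∀ i, relaxed G c A f b₀ i b₀ = if i = f a₀ then c i b₀ - 1 else c i b₀ := by
    intro i
    simp only [relaxed, if_true, hab, mem_singleton, exists_eq_left]
    simp only [eq_comm]
  have hwb : wt c b₀ + 5 ≤ wt (relaxed G c A f b₀) b₀ + 9 * (#(nb G A b₀) : ℤ) := by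
    have := hbd b₀
    rw [hab, card_singleton]
    simp only [wt, hrel]
    generalize f a₀ = j at hc
    cases j <;> simp at hc ⊢ <;> omega
  have hother : ∀ b, b ≠ b₀ → ∀ i, relaxed G c A f b₀ i b = blocked G c A f i b := by
    intro b hb i
    rw [relaxed, if_neg hb]
  have hbounded : Bounded (relaxed G c A f b₀) := by
    intro b
    by_cases hb : b = b₀
    · subst hb
      have := hbd b
      simp only [hrel]
      generalize f a₀ = j at hc
      cases j <;> simp at hc ⊢ <;> omega
    · simp only [hother b hb]
      exact hbd.blocked A f b
  have hw : ∀ b ∈ U \ A, wt c b ≤ wt (relaxed G c A f b₀) b + 9 * #(nb G A b) := by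
    intro b _
    by_cases hb : b = b₀
    · subst hb
      omega
    · have := wt_le_wt_blocked (G := G) hbd A f b
      simp only [wt, hother b hb] at this ⊢
      exact this
  rcases h.defect hA hmin hle hbounded hw (h.not_valid_relaxed hA.1 hf hab hs) with h1 | h1
  · have := h1.2 b₀ hb₀
    omega
  · have := (h1.2 b₀ hb₀).2
    omega

lemma Critical.defect_blocked {c : Bool → V → ℤ} {U A : Finset V} (h : Critical G c U)
    (hA : Regular G c U A) (hmin : ∀ B, Regular G c U B → pot G c A ≤ pot G c B)
    (hle : pot G c A ≤ 1) {f : V → Bool} (hf : Valid G c A f) {b : V} (hb : b ∈ U \ A)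
    (hn : (nb G A b).Nonempty) :
    -2 ≤ pot G c A ∧ ((∃ a, nb G A b = {a} ∧ f a = false ∧ 2 ≤ c false b) ∨
      (-1 ≤ pot G c A ∧ ∃ a, nb G A b = {a} ∧ f a = true ∧ c true b = 1 ∧ c false b = -1) ∨
      (c true b = 1 ∧ c false b = 3 ∧ #(nb G A b) = 2)) := by
  have hbd := h.bounded
  have hb' := hbd b
  have hd := h.defect hA hmin hle (hbd.blocked A f)
    (fun b _ => wt_le_wt_blocked hbd A f b) (h.not_valid_blocked hA.1 hf)
  have hd' : (pot G c A = 1 ∧ wt (blocked G c A f) b + 9 * (#(nb G A b) : ℤ) = wt c b) ∨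
      (-2 ≤ pot G c A ∧ blocked G c A f false b = -1 ∧
      wt (blocked G c A f) b + 9 * (#(nb G A b) : ℤ) ≤ wt c b + pot G c A + 2) := by
    rcases hd with h1 | h1
    · exact Or.inl ⟨h1.1, h1.2 b hb⟩
    · exact Or.inr ⟨h1.1, h1.2 b hb⟩
  clear hd
  have h1 := two_le_card_nb (G := G) (A := A) (f := f) (b := b)
  have hpos := card_pos.2 hn
  by_cases hone : #(nb G A b) = 1
  · obtain ⟨a, ha⟩ := card_eq_one.1 hone
    simp only [wt, blocked, ha, mem_singleton, exists_eq_left] at hd'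
    cases hfa : f a
    · simp [hfa] at hd'
      refine ⟨by omega, Or.inl ⟨a, ha, hfa, by omega⟩⟩
    · simp [hfa] at hd'
      refine ⟨by omega, Or.inr (Or.inl ⟨by omega, a, ha, hfa, by omega, by omega⟩)⟩
  · by_cases p : ∃ a ∈ nb G A b, f a = true <;> by_cases q : ∃ a ∈ nb G A b, f a = false <;>
      simp only [p, q, wt, blocked, if_true, if_false] at hd'
    · refine ⟨by omega, Or.inr (Or.inr ⟨by omega, by omega, by omega⟩)⟩
    · omega
    · omega
    · omega

lemma Critical.two_le_pot {c : Bool → V → ℤ} {U : Finset V} (h : Critical G c U) {A : Finset V}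
    (hA : Regular G c U A) : 2 ≤ pot G c A := by
  classical
  by_contra hcon
  obtain ⟨A', hA', hmin'⟩ := exists_min_image (U.powerset.filter (Regular G c U)) (pot G c)
    ⟨A, by simp [hA, hA.1]⟩
  have hle : pot G c A' ≤ 1 := by
    have := hmin' A (by simp [hA, hA.1])
    omega
  have hmin : ∀ B, Regular G c U B → pot G c A' ≤ pot G c B := fun B hB =>
    hmin' B (by simp [hB, hB.1])
  have hA : Regular G c U A' := (mem_filter.1 hA').2
  clear hcon hA' hmin'
  generalize A' = A at *
  have hbd := h.bounded
  have hsparse : ∀ B ⊆ A, Sparse G c B := fun B hB => h.sparse.mono (hB.trans hA.1)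
  obtain ⟨f, hf⟩ := h.exists_valid A hA.ssubset c hbd (hsparse A subset_rfl)
  have hex : ∃ b ∈ U \ A, (nb G A b).Nonempty := by
    by_contra hno
    push Not at hno
    obtain ⟨g, hg⟩ := h.exists_valid (U \ A) (sdiff_ssubset hA.1 hA.2.1) c hbd
      (h.sparse.mono sdiff_subset)
    refine h.not_valid_blocked hA.1 hf g fun b hb => ?_
    have := hg b hb
    rwa [blocked, if_neg (by simp [hno b hb])]
  obtain ⟨b, hb, hn⟩ := hex
  have hbU := (mem_sdiff.1 hb).1
  have hbA := (mem_sdiff.1 hb).2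
  obtain ⟨hm, ⟨a, hab, hfa, hcb⟩ | ⟨hm', a, hab, hfa, hcb⟩ | hcb⟩ :=
    h.defect_blocked hA hmin hle hf hb hn
  · have haA : a ∈ A := (mem_nb.1 (hab ▸ mem_singleton_self a)).1
    obtain ⟨f', hf'⟩ := h.exists_lower hA.ssubset (fun i => if i = false then {a} else ∅)
      (fun B hB hn => by
        have h1 := hmin B (hA.mono hB hn)
        have h2 : #(B.filter (fun v => v ∈ ({a} : Finset V) ∧ 1 ≤ c false v)) ≤ 1 :=
          (card_le_card (fun v hv => (mem_filter.1 hv).2.1)).trans (card_singleton a).le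
        simp
        simp only [mem_singleton] at h2
        omega)
      (fun B hB hn _ => by
        have h1 := hmin B (hA.mono hB hn)
        simp
        omega)
    have hf'' := hf'.of_le (fun i v _ => lower_le hbd _ i v)
    obtain ⟨-, ⟨a', hab', hfa', -⟩ | ⟨-, a', -, -, -, hcb'⟩ | hcb'⟩ :=
      h.defect_blocked hA hmin hle hf'' hb hn
    · obtain rfl : a = a' := by rw [hab] at hab'; exact singleton_injective hab'
      refine h.defect_relaxed hA hmin hle hf'' hb hab (by rw [hfa']; omega)
        (hf'.strict haA (by simp [hfa']))
    · omega
    · rw [hab] at hcb'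
      simp at hcb'
  · have haA : a ∈ A := (mem_nb.1 (hab ▸ mem_singleton_self a)).1
    obtain ⟨f', hf'⟩ := h.exists_lower hA.ssubset (fun i => if i = true then {a} else ∅)
      (fun B hB hn => by
        have h1 := hmin B (hA.mono hB hn)
        have h2 : #(B.filter (fun v => v ∈ ({a} : Finset V))) ≤ 1 :=
          (card_le_card (fun v hv => (mem_filter.1 hv).2)).trans (card_singleton a).le
        simp
        simp only [mem_singleton] at h2
        omega)
      (fun B hB hn hforced => by
        have h1 := hmin B (hA.mono hB hn)
        by_cases haB : a ∈ B
        · have h2 : #(B.filter (fun v => v ∈ ({a} : Finset V))) ≤ 1 :=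
            (card_le_card (fun v hv => (mem_filter.1 hv).2)).trans (card_singleton a).le
          have hbB : b ∉ B := fun hbB => hbA (hB hbB)
          have h3 := (h.sparse (insert b B) (insert_subset hbU (hB.trans hA.1))
            (insert_nonempty _ _)).2 (by
              intro v hv
              rcases mem_insert.1 hv with rfl | hv
              · exact hcb.2
              · simpa [lower] using hforced v hv)
          rw [pot_insert c hbB, wt, hcb.1, hcb.2] at h3
          have h4 : 1 ≤ #(nb G B b) := by
            refine card_pos.2 ⟨a, mem_nb.2 ⟨haB, ?_⟩⟩
            exact (mem_nb.1 (hab ▸ mem_singleton_self a)).2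
          simp
          simp only [mem_singleton] at h2
          norm_num at h3
          omega
        · have h2 : B.filter (fun v => v = a) = ∅ := by
            rw [filter_eq_empty_iff]
            rintro v hv rfl
            exact haB hv
          simp [h2]
          omega)
    have hf'' := hf'.of_le (fun i v _ => lower_le hbd _ i v)
    obtain ⟨-, ⟨a', -, -, hcb'⟩ | ⟨-, a', hab', hfa', -⟩ | hcb'⟩ :=
      h.defect_blocked hA hmin hle hf'' hb hn
    · omega
    · obtain rfl : a = a' := by rw [hab] at hab'; exact singleton_injective hab'
      refine h.defect_relaxed hA hmin hle hf'' hb hab (by rw [hfa']; omega)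
        (hf'.strict haA (by simp [hfa']))
    · omega
  · have hU := (h.sparse U subset_rfl (hA.2.1.mono hA.1)).1
    have hpi := pot_insert (G := G) c hbA
    rw [wt, hcb.1, hcb.2.1, hcb.2.2] at hpi
    norm_num at hpi
    by_cases heq : insert b A = U
    · have hAe : A = U.erase b := by rw [← heq, erase_insert hbA]
      refine hA.2.2.2 b ?_ hAe
      simp only [twos, mem_filter]
      refine ⟨hbU, hcb.1, hcb.2.1, ?_⟩
      rw [← heq, ← hcb.2.2]
      congr 1
      ext u
      simp only [mem_nb, mem_insert]
      constructor
      · rintro ⟨rfl | hu, hu2⟩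
        · simp at hu2
        · exact ⟨hu, hu2⟩
      · tauto
    · by_cases hr : Regular G c U (insert b A)
      · have := hmin _ hr
        omega
      · apply hr
        refine ⟨insert_subset hbU hA.1, insert_nonempty _ _, heq, fun v hv he => ?_⟩
        have := pot_erase_twos hv
        rw [← he] at this
        omega

lemma mem_twos {c : Bool → V → ℤ} {U : Finset V} {v : V} :
    v ∈ twos G c U ↔ v ∈ U ∧ c true v = 1 ∧ c false v = 3 ∧ #(nb G U v) = 2 := by
  simp [twos]

lemma nb_mono {A B : Finset V} (h : A ⊆ B) (v : V) : nb G A v ⊆ nb G B v :=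
  filter_subset_filter _ h

lemma Critical.exists_lower_erase {c : Bool → V → ℤ} {U : Finset V} (h : Critical G c U) {v : V}
    (hv : v ∈ twos G c U) (T : Finset V) (hT : #(T.filter (fun u => 1 ≤ c false u)) ≤ 1) :
    ∃ f, Valid G (lower c (fun i => if i = false then T else ∅)) (U.erase v) f := by
  have hvU := (mem_twos.1 hv).1
  have key : ∀ B ⊆ U.erase v, B.Nonempty → -1 ≤ pot G c B := by
    intro B hB hn
    by_cases hBe : B = U.erase v
    · have h1 := pot_erase_twos hv
      have h2 := (h.sparse U subset_rfl ⟨v, hvU⟩).1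
      rw [hBe]
      omega
    · have hvB : v ∉ B := fun hvB => notMem_erase v U (hB hvB)
      have : Regular G c U B := by
        refine ⟨hB.trans (erase_subset _ _), hn, fun he => hvB (he ▸ hvU), fun v' hv' he => ?_⟩
        by_cases hvv : v = v'
        · exact hBe (hvv ▸ he)
        · exact hvB (he ▸ mem_erase.2 ⟨hvv, hvU⟩)
      have := h.two_le_pot this
      omega
  refine h.exists_lower (erase_ssubset hvU) _ (fun B hB hn => ?_) (fun B hB hn _ => ?_)
  · have h1 := key B hB hn
    have h2 : #(B.filter (fun v => v ∈ T ∧ 1 ≤ c false v)) ≤ 1 := by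
      refine le_trans (card_le_card fun u hu => ?_) hT
      simp only [mem_filter] at hu ⊢
      exact hu.2
    simp
    omega
  · have h1 := key B hB hn
    simp
    omega

lemma Critical.of_adj_twos {c : Bool → V → ℤ} {U : Finset V} (h : Critical G c U) {v x : V}
    (hv : v ∈ twos G c U) (hx : x ∈ nb G U v) :
    x ∉ twos G c U ∧ 0 ≤ c true x ∧ 1 ≤ c false x := by
  have hv' := mem_twos.1 hv
  obtain ⟨y, hy⟩ : ∃ y, (nb G U v).erase x = {y} := by
    rw [← card_eq_one, card_erase_of_mem hx, hv'.2.2.2]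
  have hnb : ∀ a ∈ nb G (U.erase v) v, a ∈ U.erase v ∧ (a = x ∨ a = y) := by
    intro a ha
    refine ⟨(mem_nb.1 ha).1, ?_⟩
    by_cases hax : a = x
    · exact Or.inl hax
    · right
      rw [← mem_singleton, ← hy, mem_erase]
      exact ⟨hax, nb_mono (erase_subset _ _) v ha⟩
  have hcard : ∀ (i : Bool) (f : V → Bool), (#((nb G (U.erase v) v).filter (fun u => f u = i)) : ℤ) ≤ 2 := by
    intro i f
    have := (card_filter_le (nb G (U.erase v) v) (fun u => f u = i)).trans
      (card_le_card (nb_mono (G := G) (erase_subset v U) v))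
    omega
  have hxe : x ∈ U.erase v := mem_erase.2 ⟨(mem_nb.1 hx).2.ne', (mem_nb.1 hx).1⟩
  have hbd := h.bounded
  have hle := fun (S : Bool → Finset V) (i : Bool) (u : V) (_ : u ∈ U.erase v) =>
    lower_le hbd S i u
  have hins : ∀ k, ¬ Valid G c (insert v (U.erase v)) k := by
    rw [insert_erase hv'.1]
    exact h.not_valid
  by_contra hcon
  have hcases : c false x ≤ 0 ∨ c true x = -1 ∨ x ∈ twos G c U := by
    have := hbd x
    by_contra hno
    push Not at hno
    exact hcon ⟨hno.2.2, by omega, by omega⟩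
  rcases hcases with hc | hc | hc
  · obtain ⟨f, hf⟩ := h.exists_lower_erase hv {x, y} (by
      refine (card_le_card (t := {y}) fun u hu => ?_).trans (card_singleton y).le
      simp only [mem_filter, mem_insert, mem_singleton] at hu ⊢
      rcases hu with ⟨rfl | rfl, hu⟩
      · omega
      · rfl)
    obtain ⟨k, hk⟩ := (hf.of_le (hle _)).insert (notMem_erase v U) false
      ((hcard _ _).trans (by omega)) (fun a ha hfa => by
        obtain ⟨ha1, ha2⟩ := hnb a ha
        exact hf.strict ha1 (by simpa [hfa] using ha2))
    exact hins k hk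
  · obtain ⟨f, hf⟩ := h.exists_lower_erase hv {x} ((card_filter_le _ _).trans (card_singleton x).le)
    have hfx : f x = false := by
      by_contra hfx
      have hfx : f x = true := by simpa using hfx
      have := hf x hxe
      rw [hfx] at this
      simp [lower, hc] at this
      omega
    have hf' := hf.of_le (hle _)
    by_cases hfy : f y = true
    · obtain ⟨k, hk⟩ := hf'.insert (notMem_erase v U) false
        ((hcard _ _).trans (by omega)) (fun a ha hfa => by
          obtain ⟨ha1, rfl | rfl⟩ := hnb a ha
          · exact hf.strict ha1 (by simp [hfa])
          · simp_all)
      exact hins k hk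
    · have hno : ∀ a ∈ nb G (U.erase v) v, f a ≠ true := by
        intro a ha
        obtain ⟨ha1, rfl | rfl⟩ := hnb a ha <;> simp_all
      obtain ⟨k, hk⟩ := hf'.insert (notMem_erase v U) true (by
          rw [filter_eq_empty_iff.2 (fun {a} ha => hno a ha)]
          simp
          omega) (fun a ha hfa => absurd hfa (hno a ha))
      exact hins k hk
  · obtain ⟨f, hf⟩ := h.exists_lower_erase hv {y} ((card_filter_le _ _).trans (card_singleton y).le)
    obtain ⟨k, hk⟩ := (hf.of_le (hle _)).insert (notMem_erase v U) false
      ((hcard _ _).trans (by omega)) (fun a ha hfa => by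
        obtain ⟨ha1, rfl | rfl⟩ := hnb a ha
        · have h1 := (mem_twos.1 hc).2.2
          have := (card_filter_le (nb G (U.erase v) a) (fun u => f u = f a)).trans
            (card_le_card (nb_mono (G := G) (erase_subset v U) a))
          rw [hfa] at this ⊢
          omega
        · exact hf.strict ha1 (by simp [hfa]))
    exact hins k hk

lemma Critical.false_add_two_le {c : Bool → V → ℤ} {U : Finset V} (h : Critical G c U) {x : V}
    (hxU : x ∈ U) (hx : x ∉ twos G c U) (h1 : 0 ≤ c true x) :
    c false x + 2 ≤ #(nb G U x) := by
  by_contra hcon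
  have hbd := h.bounded
  have hbx := hbd x
  obtain ⟨f, hf⟩ := h.exists_lower (erase_ssubset hxU)
    (fun i => if i = false then nb G U x else ∅)
    (fun B hB hn => by
      have hxB : x ∉ B := fun hxB => notMem_erase x U (hB hxB)
      have hBU := hB.trans (erase_subset x U)
      have h2 := h.two_le_pot (regular_of_notMem hBU hn hxU hxB hx)
      have h3 := (h.sparse (insert x B) (insert_subset hxU hBU) (insert_nonempty _ _)).1
      rw [pot_insert c hxB, wt] at h3
      have h4 : #(B.filter (fun v => v ∈ nb G U x ∧ 1 ≤ c false v)) ≤ #(nb G B x) := by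
        refine card_le_card fun u hu => ?_
        simp only [mem_filter, mem_nb] at hu ⊢
        tauto
      simp
      omega)
    (fun B hB hn _ => by
      have hxB : x ∉ B := fun hxB => notMem_erase x U (hB hxB)
      have hBU := hB.trans (erase_subset x U)
      have h2 := h.two_le_pot (regular_of_notMem hBU hn hxU hxB hx)
      simp
      omega)
  have hf' := hf.of_le (fun i v _ => lower_le hbd _ i v)
  have hsub := nb_mono (G := G) (erase_subset x U) x
  have hcard := card_le_card hsub
  by_cases hall : ∃ a ∈ nb G (U.erase x) x, f a = true
  · obtain ⟨a, ha, hfa⟩ := hall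
    obtain ⟨k, hk⟩ := hf'.insert (notMem_erase x U) false (by
      have : #((nb G (U.erase x) x).filter (fun u => f u = false)) < #(nb G (U.erase x) x) := by
        refine card_lt_card (filter_ssubset.2 ⟨a, ha, by simp [hfa]⟩)
      omega) (fun a ha hfa => hf.strict (mem_nb.1 ha).1 (by simpa [hfa] using hsub ha))
    rw [insert_erase hxU] at hk
    exact h.not_valid k hk
  · push Not at hall
    obtain ⟨k, hk⟩ := hf'.insert (notMem_erase x U) true (by
      rw [filter_eq_empty_iff.2 (fun {a} ha => hall a ha)]
      simpa using h1) (fun a ha hfa => absurd hfa (hall a ha))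
    rw [insert_erase hxU] at hk
    exact h.not_valid k hk

lemma Critical.exists_lower_both {c : Bool → V → ℤ} {U A : Finset V} (h : Critical G c U) {x : V}
    (hxU : x ∈ U) (hx : x ∉ twos G c U) (hA : A ⊆ U) (hxA : x ∉ A) (y : V) :
    ∃ f, Valid G (lower c (fun _ => {y})) A f := by
  have h1 : ∀ B : Finset V, #(B.filter (fun v => v ∈ ({y} : Finset V))) ≤ 1 := fun B =>
    (card_le_card (fun v hv => (mem_filter.1 hv).2)).trans (card_singleton y).le
  have h2 : ∀ B : Finset V, #(B.filter (fun v => v ∈ ({y} : Finset V) ∧ 1 ≤ c false v)) ≤ 1 :=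
    fun B => (card_le_card (fun v hv => (mem_filter.1 hv).2.1)).trans (card_singleton y).le
  have h3 : ∀ B ⊆ A, B.Nonempty → 2 ≤ pot G c B := fun B hB hn =>
    h.two_le_pot (regular_of_notMem (hB.trans hA) hn hxU (fun hxB => hxA (hB hxB)) hx)
  refine h.exists_lower (hA.ssubset_of_ne (by rintro rfl; exact hxA hxU)) _ (fun B hB hn => ?_)
    (fun B hB hn _ => ?_)
  · have := h1 B
    have := h2 B
    have := h3 B hB hn
    omega
  · have := h1 B
    have := h3 B hB hn
    omega

lemma Critical.two_le_wt {c : Bool → V → ℤ} {U : Finset V} (h : Critical G c U) {x z : V}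
    (hxU : x ∈ U) (hz : z ∈ nb G U x) : 2 ≤ wt c x := by
  rw [← pot_singleton (G := G) c x]
  apply h.two_le_pot
  refine ⟨by simpa, singleton_nonempty x, ?_, ?_⟩
  · rintro rfl
    have := mem_nb.1 hz
    simp at this
    simp [this.1] at this
  · intro v hv he
    have h1 : nb G U v ⊆ {x} := by
      intro u hu
      rw [he]
      exact mem_erase.2 ⟨(mem_nb.1 hu).2.ne', (mem_nb.1 hu).1⟩
    have h2 := card_le_card h1
    rw [(mem_twos.1 hv).2.2.2] at h2
    simp at h2

lemma Critical.two_le_card_nb {c : Bool → V → ℤ} {U : Finset V} (h : Critical G c U) {x : V}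
    (hxU : x ∈ U) (hx : x ∉ twos G c U) : 2 ≤ #(nb G U x) := by
  by_contra hcon
  have hbd := h.bounded
  have hbx := hbd x
  have hsub := nb_mono (G := G) (erase_subset x U) x
  rcases (nb G U x).eq_empty_or_nonempty with he | ⟨z, hz⟩
  · have hne : nb G (U.erase x) x = ∅ := subset_empty.1 (he ▸ hsub)
    obtain ⟨f, hf⟩ := h.exists_lower_both hxU hx (erase_subset x U) (notMem_erase x U) x
    have hf' := hf.of_le (fun i v _ => lower_le hbd _ i v)
    have hex : ∃ i, 0 ≤ c i x := by
      by_contra hno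
      push Not at hno
      have h1 := hno true
      have h2 := hno false
      have h3 := (h.sparse {x} (by simpa) (singleton_nonempty x)).2 (by
        intro v hv
        rw [mem_singleton.1 hv]
        omega)
      rw [pot_singleton, wt] at h3
      omega
    obtain ⟨i, hi⟩ := hex
    obtain ⟨k, hk⟩ := hf'.insert (notMem_erase x U) i (by simpa [hne] using hi)
      (by simp [hne])
    rw [insert_erase hxU] at hk
    exact h.not_valid k hk
  · have hz1 : nb G U x = {z} := by
      obtain ⟨w, hw⟩ := card_eq_one.1
        (le_antisymm (by omega : #(nb G U x) ≤ 1) (card_pos.2 ⟨z, hz⟩))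
      rw [hw] at hz ⊢
      rw [mem_singleton.1 hz]
    obtain ⟨f, hf⟩ := h.exists_lower_both hxU hx (erase_subset x U) (notMem_erase x U) z
    have hf' := hf.of_le (fun i v _ => lower_le hbd _ i v)
    have hw := h.two_le_wt hxU hz
    have hex : ∃ i, 1 ≤ c i x := by
      by_contra hno
      push Not at hno
      have h1 := hno true
      have h2 := hno false
      rw [wt] at hw
      omega
    obtain ⟨i, hi⟩ := hex
    obtain ⟨k, hk⟩ := hf'.insert (notMem_erase x U) i (by
        have := (card_filter_le (nb G (U.erase x) x) (fun u => f u = i)).trans (card_le_card hsub)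
        rw [hz1, card_singleton] at this
        omega)
      (fun a ha _ => hf.strict (mem_nb.1 ha).1 (hz1 ▸ hsub ha))
    rw [insert_erase hxU] at hk
    exact h.not_valid k hk

/-- Extending a coloring to `x` and a set `T` of vertices having at most one neighbour in the
colored part. -/
lemma Valid.insert_union {c : Bool → V → ℤ} {A T : Finset V} {f : V → Bool} {x : V}
    (hf : Valid G c A f) (hxA : x ∉ A) (hAT : Disjoint A T) (hxT : x ∉ T)
    (hT : ∀ v ∈ T, ∀ i, 1 ≤ c i v) (hind : ∀ v ∈ T, nb G T v = ∅)
    (hone : ∀ v ∈ T, #(nb G A v) ≤ 1)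
    (hz : ∀ z ∈ nb G A x, (#((nb G A z).filter (fun u => f u = f z)) : ℤ) + 1 ≤ c (f z) z)
    (hcard : (#(nb G A x) : ℤ) + #(nb G T x) ≤ c true x + c false x + 1) :
    ∃ k, Valid G c (Insert.insert x (A ∪ T)) k := by
  classical
  set f' : V → Bool := fun v => if v ∈ A then f v else decide (∀ a ∈ nb G A v, f a = false)
    with hf'
  have hfA : ∀ v ∈ A, f' v = f v := fun v hv => if_pos hv
  have hTA : ∀ v ∈ T, v ∉ A := fun v hv hvA => disjoint_left.1 hAT hvA hv
  have hopp : ∀ v ∈ T, ∀ a ∈ nb G A v, f a ≠ f' v := by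
    intro v hv a ha
    simp only [hf', if_neg (hTA v hv)]
    have huniq : ∀ b ∈ nb G A v, b = a := fun b hb => card_le_one.1 (hone v hv) b hb a ha
    cases hfa : f a
    · intro hd
      refine of_decide_eq_false hd.symm fun b hb => ?_
      rw [huniq b hb, hfa]
    · intro hd
      have := of_decide_eq_true hd.symm a ha
      simp [hfa] at this
  have hsA : ∀ v ∈ A, (nb G (A ∪ T) v).filter (fun u => f' u = f' v) ⊆
      (nb G A v).filter (fun u => f u = f v) := by
    intro v hv u hu
    simp only [mem_filter, mem_nb, mem_union] at hu ⊢
    obtain ⟨⟨hu1, hu2⟩, hu3⟩ := hu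
    by_cases huA : u ∈ A
    · rw [hfA u huA, hfA v hv] at hu3
      exact ⟨⟨huA, hu2⟩, hu3⟩
    · have huT : u ∈ T := by tauto
      rw [hfA v hv] at hu3
      exact absurd hu3.symm (hopp u huT v (mem_nb.2 ⟨hv, hu2.symm⟩))
  have hsT : ∀ v ∈ T, (nb G (A ∪ T) v).filter (fun u => f' u = f' v) = ∅ := by
    intro v hv
    rw [filter_eq_empty_iff]
    intro u hu
    rw [nb_union, hind v hv, union_empty] at hu
    rw [hfA u (mem_nb.1 hu).1]
    exact hopp v hv u hu
  have hval : Valid G c (A ∪ T) f' := by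
    intro v hv
    rcases mem_union.1 hv with hv | hv
    · have := card_le_card (hsA v hv)
      have := hf v hv
      rw [hfA v hv] at *
      omega
    · rw [hsT v hv]
      have := hT v hv (f' v)
      simp only [card_empty, Nat.cast_zero]
      omega
  have hsplit := card_filter_add_card_filter_not (s := nb G (A ∪ T) x) (fun u => f' u = true)
  simp only [Bool.not_eq_true] at hsplit
  rw [card_nb_union hAT] at hsplit
  have hex : ∃ i, (#((nb G (A ∪ T) x).filter (fun u => f' u = i)) : ℤ) ≤ c i x := by
    by_contra hno
    push Not at hno
    have h1 := hno true
    have h2 := hno false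
    omega
  obtain ⟨i, hi⟩ := hex
  refine hval.insert (by simp [hxA, hxT]) i hi fun a ha _ => ?_
  rcases mem_union.1 (mem_nb.1 ha).1 with haA | haT
  · have h1 := hz a (mem_nb.2 ⟨haA, (mem_nb.1 ha).2⟩)
    have h2 := card_le_card (hsA a haA)
    rw [hfA a haA] at *
    omega
  · rw [hsT a haT]
    simpa using hT a haT (f' a)

lemma Critical.nb_twos_eq_empty {c : Bool → V → ℤ} {U T : Finset V} (h : Critical G c U)
    (hT : T ⊆ twos G c U) {v : V} (hv : v ∈ T) : nb G T v = ∅ := by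
  rw [eq_empty_iff_forall_notMem]
  intro u hu
  have hu' := mem_nb.1 hu
  have huU := (mem_twos.1 (hT hu'.1)).1
  exact (h.of_adj_twos (hT hv) (mem_nb.2 ⟨huU, hu'.2⟩)).1 (hT hu'.1)

lemma card_nb_le_one_of_mem_twos {c : Bool → V → ℤ} {U A : Finset V} {v x : V}
    (hv : v ∈ twos G c U) (hA : A ⊆ U) (hxU : x ∈ U) (hxA : x ∉ A) (hvx : G.Adj v x) :
    #(nb G A v) ≤ 1 := by
  have h1 : nb G A v ⊆ (nb G U v).erase x := by
    intro u hu
    refine mem_erase.2 ⟨?_, nb_mono hA v hu⟩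
    rintro rfl
    exact hxA (mem_nb.1 hu).1
  have h2 := card_le_card h1
  rw [card_erase_of_mem (mem_nb.2 ⟨hxU, hvx⟩), (mem_twos.1 hv).2.2.2] at h2
  exact h2

lemma Critical.add_three_le_card_nb {c : Bool → V → ℤ} {U : Finset V} (h : Critical G c U) {x : V}
    (hxU : x ∈ U) (hx : x ∉ twos G c U) (hnb : nb G U x ⊆ twos G c U) :
    c true x + c false x + 3 ≤ #(nb G U x) := by
  by_contra hcon
  have hbd := h.bounded
  obtain ⟨v, hv⟩ := card_pos.1 (lt_of_lt_of_le two_pos (h.two_le_card_nb hxU hx))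
  have hv' := mem_twos.1 (hnb hv)
  have hvx : x ∈ nb G U v := mem_nb.2 ⟨hxU, (mem_nb.1 hv).2.symm⟩
  obtain ⟨y, hy⟩ : ∃ y, (nb G U v).erase x = {y} := by
    rw [← card_eq_one, card_erase_of_mem hvx, hv'.2.2.2]
  have hy' : y ∈ (nb G U v).erase x := hy ▸ mem_singleton_self y
  have hyx := (mem_erase.1 hy').1
  have hyt := (h.of_adj_twos (hnb hv) (mem_erase.1 hy').2).1
  obtain ⟨T, hTdef⟩ : ∃ T, T = (nb G U x).erase v := ⟨_, rfl⟩
  obtain ⟨A, hAdef⟩ : ∃ A, A = (U.erase x) \ nb G U x := ⟨_, rfl⟩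
  have hTx : T ⊆ nb G U x := hTdef ▸ erase_subset _ _
  have hAU : A ⊆ U := hAdef ▸ sdiff_subset.trans (erase_subset _ _)
  have hTt : T ⊆ twos G c U := hTx.trans hnb
  have hxA : x ∉ A := by simp [hAdef]
  have hxT : x ∉ T := fun hxT => hx (hTt hxT)
  obtain ⟨f, hf⟩ := h.exists_lower_both hxU hx hAU hxA y
  have hlow : ∀ u, u ≠ y → ∀ i, lower c (fun _ => {y}) i u = c i u := by
    intro u hu i
    simp [lower, hu]
  have hnbA : nb G A x = ∅ := by
    rw [eq_empty_iff_forall_notMem]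
    intro u hu
    have hu' := mem_nb.1 hu
    rw [hAdef] at hu'
    exact (mem_sdiff.1 hu'.1).2 (nb_mono hAU x hu)
  obtain ⟨k, hk⟩ := hf.insert_union (x := x) (T := T) hxA
    (hAdef ▸ disjoint_of_subset_right hTx sdiff_disjoint) hxT
    (fun u hu i => by
      have hu' := mem_twos.1 (hTt hu)
      rw [hlow u (by rintro rfl; exact hyt (hTt hu))]
      cases i <;> omega)
    (fun u hu => h.nb_twos_eq_empty hTt hu)
    (fun u hu => card_nb_le_one_of_mem_twos (hTt hu) hAU hxU hxA
      (mem_nb.1 (hTx hu)).2.symm)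
    (by simp [hnbA])
    (by
      have h1 : #(nb G T x) ≤ #(nb G U x) - 1 := by
        refine (card_filter_le _ _).trans ?_
        rw [hTdef, card_erase_of_mem hv]
      have := card_pos.2 ⟨v, hv⟩
      rw [hnbA, hlow x hyx.symm, hlow x hyx.symm]
      simp only [card_empty, Nat.cast_zero]
      omega)
  have hW : insert v (insert x (A ∪ T)) = U := by
    ext u
    simp only [hAdef, hTdef, mem_insert, mem_union, mem_sdiff, mem_erase]
    by_cases huv : u = v
    · simp [huv, hv'.1]
    · by_cases hux : u = x
      · simp [hux, hxU]
      · by_cases hun : u ∈ nb G U x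
        · simp [hun, huv, (mem_nb.1 hun).1]
        · simp [hun, huv, hux]
  have hvW : v ∉ insert x (A ∪ T) := by
    simp only [hAdef, hTdef, mem_insert, mem_union, mem_sdiff, mem_erase]
    have := (mem_nb.1 hv).2.ne'
    tauto
  have hWU : insert x (A ∪ T) ⊆ U := hW ▸ subset_insert _ _
  have hxy : ∀ a ∈ nb G (insert x (A ∪ T)) v, a = x ∨ a = y := by
    intro a ha
    by_cases hax : a = x
    · exact Or.inl hax
    · right
      rw [← mem_singleton, ← hy]
      exact mem_erase.2 ⟨hax, nb_mono hWU v ha⟩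
  have hkx : ∀ a ∈ nb G (insert x (A ∪ T)) v, k a = !(k x) → a = y := by
    intro a ha hka
    rcases hxy a ha with rfl | rfl
    · simp at hka
    · rfl
  obtain ⟨k', hk'⟩ := (hk.of_le (fun i v _ => lower_le hbd _ i v)).insert hvW (!(k x)) (by
      have h1 : (nb G (insert x (A ∪ T)) v).filter (fun u => k u = !(k x)) ⊆ {y} := by
        intro a ha
        rw [mem_singleton]
        exact hkx a (mem_filter.1 ha).1 (mem_filter.1 ha).2
      have h2 := card_le_card h1
      rw [card_singleton] at h2
      have h3 : 1 ≤ c (!(k x)) v := by cases k x <;> simp [hv'.2.1, hv'.2.2.1]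
      omega)
    (fun a ha hka => hk.strict (mem_nb.1 ha).1 (by simpa using hkx a ha hka))
  rw [hW] at hk'
  exact h.not_valid k' hk'

lemma Critical.add_two_le_card_nb {c : Bool → V → ℤ} {U : Finset V} (h : Critical G c U) {x : V}
    (hxU : x ∈ U) (hx : x ∉ twos G c U) (hnb : #(nb G U x \ twos G c U) = 1) :
    c true x + c false x + 2 ≤ #(nb G U x) := by
  by_contra hcon
  have hbd := h.bounded
  obtain ⟨z, hz⟩ := card_eq_one.1 hnb
  obtain ⟨T, hTdef⟩ : ∃ T, T = nb G U x ∩ twos G c U := ⟨_, rfl⟩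
  obtain ⟨A, hAdef⟩ : ∃ A, A = (U.erase x) \ T := ⟨_, rfl⟩
  have hTt : T ⊆ twos G c U := hTdef ▸ inter_subset_right
  have hTx : T ⊆ nb G U x := hTdef ▸ inter_subset_left
  have hAU : A ⊆ U := hAdef ▸ sdiff_subset.trans (erase_subset _ _)
  have hxA : x ∉ A := by simp [hAdef]
  have hxT : x ∉ T := fun hxT => hx (hTt hxT)
  obtain ⟨f, hf⟩ := h.exists_lower_both hxU hx hAU hxA z
  have hnbA : nb G A x ⊆ {z} := by
    rw [← hz]
    intro u hu
    refine mem_sdiff.2 ⟨nb_mono hAU x hu, fun hut => ?_⟩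
    have huA := (mem_nb.1 hu).1
    rw [hAdef, hTdef] at huA
    exact (mem_sdiff.1 huA).2 (mem_inter.2 ⟨nb_mono hAU x hu, hut⟩)
  obtain ⟨k, hk⟩ := (hf.of_le (fun i v _ => lower_le hbd _ i v)).insert_union (x := x) (T := T) hxA
    (hAdef ▸ sdiff_disjoint) hxT
    (fun u hu i => by
      have hu' := mem_twos.1 (hTt hu)
      cases i <;> omega)
    (fun u hu => h.nb_twos_eq_empty hTt hu)
    (fun u hu => card_nb_le_one_of_mem_twos (hTt hu) hAU hxU hxA (mem_nb.1 (hTx hu)).2.symm)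
    (fun a ha => hf.strict (mem_nb.1 ha).1 (hnbA ha))
    (by
      have h1 : #(nb G T x) ≤ #T := card_filter_le _ _
      have h2 := card_le_card hnbA
      have h3 := card_sdiff_add_card_inter (nb G U x) (twos G c U)
      rw [card_singleton] at h2
      rw [hnb, ← hTdef] at h3
      omega)
  have hW : insert x (A ∪ T) = U := by
    have : T ⊆ U.erase x := fun u hu =>
      mem_erase.2 ⟨(mem_nb.1 (hTx hu)).2.ne', (mem_nb.1 (hTx hu)).1⟩
    rw [hAdef, sdiff_union_of_subset this, insert_erase hxU]
  rw [hW] at hk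
  exact h.not_valid k hk

lemma charge_bounds {c₁ c₂ r k : ℤ} (hc : -1 ≤ c₁ ∧ c₁ ≤ 1) (hc' : -1 ≤ c₂ ∧ c₂ ≤ 3)
    (hr : 0 ≤ r) (hk : 0 ≤ k) (hw : 2 ≤ 4 * c₁ + 3 * max c₂ 0 + 1) (hd : 2 ≤ r + k)
    (h₁ : 0 ≤ c₁ → c₂ + 2 ≤ r + k) (hk₁ : 1 ≤ k → 0 ≤ c₁ ∧ 1 ≤ c₂)
    (hr₀ : r = 0 → c₁ + c₂ + 3 ≤ r + k) (hr₁ : r = 1 → c₁ + c₂ + 2 ≤ r + k) {q : ℤ}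
    (hq : q = 2 * (4 * c₁ + 3 * max c₂ 0 + 1) - 9 * r - 4 * k) :
    q ≤ 0 ∧ (-10 ≤ q → c₂ < r → c₁ = 1 ∧ q ≤ -6 ∧ (k ≤ 1 ∨ k = 2 ∧ q = -10)) ∧
      (q = 0 → 1 ≤ k → r < c₂) := by
  omega

/-- The charge of a vertex `x` after the degree-two vertices have taken theirs. -/
def charge (G : SimpleGraph V) [DecidableRel G.Adj] (c : Bool → V → ℤ) (U : Finset V) (x : V) : ℤ :=
  2 * wt c x - 9 * #(nb G (U \ twos G c U) x) - 4 * #(nb G (twos G c U) x)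

lemma Critical.charge_bounds {c : Bool → V → ℤ} {U : Finset V} (h : Critical G c U) {x : V}
    (hx : x ∈ U \ twos G c U) :
    charge G c U x ≤ 0 ∧
      (-10 ≤ charge G c U x → c false x < #(nb G (U \ twos G c U) x) →
        c true x = 1 ∧ charge G c U x ≤ -6 ∧
          (#(nb G (twos G c U) x) ≤ 1 ∨ #(nb G (twos G c U) x) = 2 ∧ charge G c U x = -10)) ∧
      (charge G c U x = 0 → (nb G (twos G c U) x).Nonempty →
        #(nb G (U \ twos G c U) x) < c false x) := by
  obtain ⟨hxU, hxt⟩ := mem_sdiff.1 hx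
  have hsub : twos G c U ⊆ U := filter_subset _ _
  have hsplit : #(nb G U x) = #(nb G (U \ twos G c U) x) + #(nb G (twos G c U) x) := by
    rw [← card_nb_union sdiff_disjoint, sdiff_union_of_subset hsub]
  have hnbs : nb G U x \ twos G c U = nb G (U \ twos G c U) x := by
    ext u
    simp only [mem_sdiff, mem_nb]
    tauto
  have h1 := h.two_le_card_nb hxU hxt
  obtain ⟨z, hz⟩ := card_pos.1 (two_pos.trans_le h1)
  have h2 := h.two_le_wt hxU hz
  have h3 := h.false_add_two_le hxU hxt
  have h4 : (nb G (twos G c U) x).Nonempty → 0 ≤ c true x ∧ 1 ≤ c false x := by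
    rintro ⟨v, hv⟩
    obtain ⟨hv1, hv2⟩ := mem_nb.1 hv
    exact (h.of_adj_twos hv1 (mem_nb.2 ⟨hxU, hv2.symm⟩)).2
  have h5 : #(nb G (U \ twos G c U) x) = 0 → c true x + c false x + 3 ≤ #(nb G U x) := by
    rw [← hnbs, card_eq_zero, sdiff_eq_empty_iff_subset]
    exact h.add_three_le_card_nb hxU hxt
  have h6 : #(nb G (U \ twos G c U) x) = 1 → c true x + c false x + 2 ≤ #(nb G U x) := by
    rw [← hnbs]
    exact h.add_two_le_card_nb hxU hxt
  rw [← card_pos] at h4 ⊢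
  have hb := h.bounded x
  have := DefectiveColoring.charge_bounds (r := #(nb G (U \ twos G c U) x))
    (k := #(nb G (twos G c U) x)) hb.1 hb.2 (by omega) (by omega) h2 (by omega) (by omega) (by omega)
    (by omega) (by omega) (q := charge G c U x) rfl
  refine ⟨this.1, fun ha hb => ?_, fun ha hb => this.2.2 ha (by omega)⟩
  have := this.2.1 ha hb
  omega

lemma Critical.two_mul_pot_eq {c : Bool → V → ℤ} {U : Finset V} (h : Critical G c U) :
    2 * pot G c U = ∑ x ∈ U \ twos G c U, charge G c U x := by
  have hsub : twos G c U ⊆ U := filter_subset _ _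
  have hsplit : ∀ x, (#(nb G U x) : ℤ) = #(nb G (U \ twos G c U) x) + #(nb G (twos G c U) x) := by
    intro x
    rw [← Nat.cast_add, ← card_nb_union sdiff_disjoint, sdiff_union_of_subset hsub]
  rw [two_mul_pot, ← sum_sdiff hsub]
  have h1 : ∑ v ∈ twos G c U, (2 * wt c v - 9 * (#(nb G U v) : ℤ)) =
      5 * ∑ v ∈ twos G c U, (#(nb G (U \ twos G c U) v) : ℤ) := by
    rw [mul_sum]
    refine sum_congr rfl fun v hv => ?_
    have h2 := hsplit v
    rw [h.nb_twos_eq_empty subset_rfl hv, card_empty] at h2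
    have h3 := mem_twos.1 hv
    rw [wt, h3.2.1, h3.2.2.1]
    norm_num
    omega
  rw [h1, sum_nb_comm, mul_sum, ← sum_add_distrib]
  refine sum_congr rfl fun x _ => ?_
  rw [hsplit, charge]
  ring

lemma not_critical {c : Bool → V → ℤ} {U : Finset V} (h : Critical G c U) : False := by
  have hsub : twos G c U ⊆ U := filter_subset _ _
  have hne : U.Nonempty := by
    rw [nonempty_iff_ne_empty]
    rintro rfl
    exact h.not_valid (fun _ => true) (by simp [Valid])
  have hsum : -10 ≤ ∑ x ∈ U \ twos G c U, charge G c U x := by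
    rw [← h.two_mul_pot_eq]
    have := (h.sparse U subset_rfl hne).1
    omega
  have hnp : ∀ x ∈ U \ twos G c U, charge G c U x ≤ 0 := fun x hx => (h.charge_bounds hx).1
  have hone : ∀ x ∈ U \ twos G c U, -10 ≤ charge G c U x := fun x hx => by
    have h1 := add_sum_erase _ (charge G c U) hx
    have h2 : ∑ y ∈ (U \ twos G c U).erase x, charge G c U y ≤ 0 :=
      sum_nonpos fun y hy => hnp y (mem_of_mem_erase hy)
    omega
  have htwo : ∀ x ∈ U \ twos G c U, ∀ y ∈ U \ twos G c U, y ≠ x →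
      -10 ≤ charge G c U x + charge G c U y := fun x hx y hy hxy => by
    have hy' := mem_erase.2 ⟨hxy, hy⟩
    have h1 := add_sum_erase _ (charge G c U) hx
    have h2 := add_sum_erase _ (charge G c U) hy'
    have h3 : ∑ z ∈ ((U \ twos G c U).erase x).erase y, charge G c U z ≤ 0 :=
      sum_nonpos fun z hz => hnp z (mem_of_mem_erase (mem_of_mem_erase hz))
    omega
  obtain ⟨X, hX⟩ : ∃ X, X = (U \ twos G c U).filter
    (fun x => c false x < #(nb G (U \ twos G c U) x)) := ⟨_, rfl⟩
  have hmemX : ∀ x, x ∈ X ↔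
      x ∈ U \ twos G c U ∧ c false x < #(nb G (U \ twos G c U) x) := by simp [hX]
  have hXprop : ∀ x ∈ X, c true x = 1 ∧ charge G c U x ≤ -6 ∧ (#(nb G (twos G c U) x) ≤ 1 ∨
      #(nb G (twos G c U) x) = 2 ∧ charge G c U x = -10) := by
    intro x hx
    rw [hmemX] at hx
    exact (h.charge_bounds hx.1).2.1 (hone x hx.1) hx.2
  have hXcard : #X ≤ 1 := by
    rw [card_le_one]
    intro x hx y hy
    by_contra hxy
    have := htwo x ((hmemX x).1 hx).1 y ((hmemX y).1 hy).1 (Ne.symm hxy)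
    have := (hXprop x hx).2.1
    have := (hXprop y hy).2.1
    omega
  obtain ⟨W, hWt, hW1, hWX, hWo⟩ : ∃ W ⊆ twos G c U, #W ≤ 1 ∧
      (∀ x ∈ X, #(nb G (twos G c U \ W) x) ≤ 1) ∧
      ∀ u ∈ U \ twos G c U, u ∉ X → (#(nb G (U \ twos G c U) u) : ℤ) + #(nb G W u) ≤ c false u := by
    have hle : ∀ u ∈ U \ twos G c U, u ∉ X → #(nb G (U \ twos G c U) u) ≤ c false u := by
      intro u hu huX
      rw [hmemX] at huX
      exact not_lt.1 fun hlt => huX ⟨hu, hlt⟩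
    by_cases hall : ∀ x ∈ X, #(nb G (twos G c U) x) ≤ 1
    · exact ⟨∅, empty_subset _, by simp, by simpa using hall, by simpa [nb] using hle⟩
    · push Not at hall
      obtain ⟨x, hx, hx2⟩ := hall
      have hxp := ((hXprop x hx).2.2.resolve_left (by omega))
      obtain ⟨v, hv⟩ := card_pos.1 (zero_lt_one.trans hx2)
      have hxB := ((hmemX x).1 hx).1
      refine ⟨{v}, singleton_subset_iff.2 (mem_nb.1 hv).1, by simp, fun y hy => ?_, fun u hu huX => ?_⟩
      · rw [card_le_one.1 hXcard y hy x hx]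
        have : nb G (twos G c U \ {v}) x ⊆ (nb G (twos G c U) x).erase v := by
          intro w hw
          simp only [mem_nb, mem_sdiff, mem_singleton, mem_erase] at hw ⊢
          tauto
        have := card_le_card this
        rw [card_erase_of_mem hv] at this
        omega
      · have hux : u ≠ x := by rintro rfl; exact huX hx
        have h0 : charge G c U u = 0 := by
          have := htwo x hxB u hu hux
          have := hnp u hu
          omega
        have hcard : #(nb G {v} u) ≤ 1 := (card_filter_le _ _).trans (card_singleton v).le
        rcases (nb G {v} u).eq_empty_or_nonempty with he | ⟨w, hw⟩
        · rw [he]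
          simpa using hle u hu huX
        · have := (h.charge_bounds hu).2.2 h0
            ⟨w, nb_mono (singleton_subset_iff.2 (mem_nb.1 hv).1) u hw⟩
          omega
  refine h.not_valid (fun v => decide (v ∈ X ∨ v ∈ twos G c U \ W)) fun v hv => ?_
  have hXt : ∀ x ∈ X, x ∉ twos G c U := fun x hx => (mem_sdiff.1 ((hmemX x).1 hx).1).2
  simp only [decide_eq_decide]
  by_cases hvX : v ∈ X
  · have hs : (nb G U v).filter (fun u => (u ∈ X ∨ u ∈ twos G c U \ W) ↔
        (v ∈ X ∨ v ∈ twos G c U \ W)) ⊆ nb G (twos G c U \ W) v := by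
      intro u hu
      obtain ⟨hu1, hu2⟩ := mem_filter.1 hu
      have hvu := (mem_nb.1 hu1).2
      rcases hu2.2 (Or.inl hvX) with huX | hut
      · exact absurd (card_le_one.1 hXcard v hvX u huX) hvu.ne
      · exact mem_nb.2 ⟨hut, hvu⟩
    have h1 := (card_le_card hs).trans (hWX v hvX)
    have h2 := (hXprop v hvX).1
    simp only [hvX, true_or, decide_true] at h1 ⊢
    omega
  by_cases hvt : v ∈ twos G c U
  · have hvt' := mem_twos.1 hvt
    by_cases hvW : v ∈ W
    · have h1 := card_filter_le (nb G U v)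
        (fun u => (u ∈ X ∨ u ∈ twos G c U \ W) ↔ (v ∈ X ∨ v ∈ twos G c U \ W))
      simp only [hvX, hvW, mem_sdiff, not_true, and_false, or_self, decide_false] at h1 ⊢
      omega
    · have hs : (nb G U v).filter (fun u => (u ∈ X ∨ u ∈ twos G c U \ W) ↔
          (v ∈ X ∨ v ∈ twos G c U \ W)) ⊆ X := by
        intro u hu
        obtain ⟨hu1, hu2⟩ := mem_filter.1 hu
        rcases hu2.2 (Or.inr (mem_sdiff.2 ⟨hvt, hvW⟩)) with huX | hut
        · exact huX
        · exact absurd (mem_sdiff.1 hut).1 (h.of_adj_twos hvt hu1).1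
      have h1 := (card_le_card hs).trans hXcard
      simp only [mem_sdiff, hvt, hvW, not_false_eq_true, and_self, or_true, decide_true] at h1 ⊢
      omega
  · have hvB := mem_sdiff.2 ⟨hv, hvt⟩
    have hnot : ¬ (v ∈ X ∨ v ∈ twos G c U \ W) := by simp [hvX, hvt]
    have hs : (nb G U v).filter (fun u => (u ∈ X ∨ u ∈ twos G c U \ W) ↔
        (v ∈ X ∨ v ∈ twos G c U \ W)) ⊆ nb G (U \ twos G c U) v ∪ nb G W v := by
      intro u hu
      obtain ⟨hu1, hu2⟩ := mem_filter.1 hu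
      have hu3 := fun hu => hnot (hu2.1 hu)
      simp only [mem_union, mem_nb, mem_sdiff] at hu1 hu3 ⊢
      tauto
    have h1 := (card_le_card hs).trans (card_union_le _ _)
    have h2 := hWo v hvB hvX
    rw [decide_eq_false hnot]
    omega

/-- Every sparse vertex set with bounded capacities can be colored. -/
theorem Sparse.exists_valid {c : Bool → V → ℤ} {U : Finset V} (hc : Bounded c)
    (h : Sparse G c U) : ∃ f, Valid G c U f := by
  induction U using Finset.strongInduction generalizing c with
  | H U ih =>
    by_contra hno
    push Not at hno
    exact not_critical ⟨hc, h, hno, fun A hA c' hc' hA' => ih A hA hc' hA'⟩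

lemma two_mul_ncard_induce [Fintype V] (A : Finset V) :
    2 * ((⊤ : G.Subgraph).induce (A : Set V)).edgeSet.ncard = ∑ v ∈ A, #(nb G A v) := by
  classical
  set H := ((⊤ : G.Subgraph).induce (A : Set V)).spanningCoe with hH
  have hadj : ∀ u v, H.Adj u v ↔ u ∈ A ∧ v ∈ A ∧ G.Adj u v := by
    intro u v
    simp [hH]
  rw [← SimpleGraph.Subgraph.edgeSet_spanningCoe, ← hH, ← SimpleGraph.coe_edgeFinset,
    Set.ncard_coe_finset, ← SimpleGraph.sum_degrees_eq_twice_card_edges]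
  symm
  refine sum_subset_zero_on_sdiff (subset_univ A) (fun v hv => ?_) (fun v hv => ?_)
  · rw [SimpleGraph.degree, card_eq_zero, eq_empty_iff_forall_notMem]
    intro u hu
    rw [SimpleGraph.mem_neighborFinset, hadj] at hu
    exact (mem_sdiff.1 hv).2 hu.1
  · rw [SimpleGraph.degree]
    congr 1
    ext u
    rw [SimpleGraph.mem_neighborFinset, hadj, mem_nb]
    tauto

end DefectiveColoring

/-- Every graph with maximum average degree at most 28/9 is (1,3)-colorable. -/
theorem stmt5 {V : Type*} [Fintype V] (G : SimpleGraph V)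
    (h : ∀ H : G.Subgraph, H.verts.Nonempty →
      (2 * H.edgeSet.ncard : ℚ) / H.verts.ncard ≤ 28 / 9) :
    Colorable13 G := by
  classical
  obtain ⟨f, hf⟩ := DefectiveColoring.Sparse.exists_valid (G := G) (U := Finset.univ)
    (c := fun i _ => if i then 1 else 3) (fun v => by simp) (fun A _ hA => by
      have h1 := h ((⊤ : G.Subgraph).induce (A : Set V)) (by simpa using hA)
      have h2 := DefectiveColoring.two_mul_ncard_induce (G := G) A
      have h3 := DefectiveColoring.two_mul_numEdges (G := G) A
      have hpos := Finset.card_pos.2 hA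
      have h4 : 0 ≤ DefectiveColoring.pot G (fun i (_ : V) => if i then 1 else 3) A := by
        rw [SimpleGraph.Subgraph.induce_verts, Set.ncard_coe_finset,
          div_le_div_iff₀ (by exact_mod_cast hpos) (by norm_num)] at h1
        have h5 : (2 * ((⊤ : G.Subgraph).induce (A : Set V)).edgeSet.ncard) * 9 ≤ 28 * A.card := by
          exact_mod_cast h1
        rw [h2] at h5
        have h6 : ((∑ v ∈ A, (DefectiveColoring.nb G A v).card : ℕ) : ℤ) * 9 ≤ 28 * A.card := by
          exact_mod_cast h5
        push_cast at h6
        rw [← h3] at h6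
        simp [DefectiveColoring.pot, DefectiveColoring.wt]
        omega
      exact ⟨by omega, fun _ => by omega⟩)
  have hcard : ∀ v i, G.neighborSet v ∩ {u | f u = i} =
      ((DefectiveColoring.nb G Finset.univ v).filter (fun u => f u = i) : Finset V) := by
    intro v i
    ext u
    simp [DefectiveColoring.mem_nb]
  refine ⟨f, fun v hv => ?_, fun v hv => ?_⟩ <;>
  · have := hf v (Finset.mem_univ v)
    rw [hcard, Set.ncard_coe_finset]
    simp only [hv] at this
    simpa using this
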